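/- Let b ≥ 1 and let i, j be two distinct agents; assume R i and R j are equivalence relations on W and the b-commutativity frame property holds for the pair (i, j) in both orders. Then any two worlds w, w' that are reachable from one another via R i and R j (i.e., related by the reflexive-transitive closure of R i ⊔ R j) are connected by a path of length exactly 2b: comp(alt(i,j,2b)) w w'. (Appendix corollary: in a C^b-S5_2-model, a world reachable in an arbitrary number of steps is reachable in exactly 2b steps.) -/

import Mathlib

/-- Relational composition along a list of agents. -/
def comp {W I : Type*} (R : I → W → W → Prop) : List I → W → W → Prop
  | [], w, v => w = v
  | i :: l, w, v => ∃ u, R i w u ∧ comp R l u v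

/-- `alt i j k` is the alternating list `[i, j, i, j, …]` of length `k`. -/
def alt {I : Type*} (i j : I) : ℕ → List I
  | 0 => []
  | k + 1 => i :: alt j i k

theorem comp_alt_refl {W I : Type*} (R : I → W → W → Prop) (i j : I)
    (hi : ∀ w, R i w w) (hj : ∀ w, R j w w) (k : ℕ) (w : W) : comp R (alt i j k) w w := by
  induction k generalizing i j with
  | zero => rfl
  | succ k ih => exact ⟨w, hi w, ih j i hj hi⟩

theorem comp_alt_of_rel_of_comp_alt {W I : Type*} (R : I → W → W → Prop) (i j : I)
    (hi : ∀ {u v w}, R i u v → R i v w → R i u w) {k : ℕ} (hk : 1 ≤ k) {u v w : W}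
    (huv : R i u v) (hvw : comp R (alt i j k) v w) : comp R (alt i j k) u w := by
  obtain ⟨k, rfl⟩ := Nat.exists_eq_add_of_le' hk
  obtain ⟨x, hvx, hxw⟩ := hvw
  exact ⟨x, hi huv hvx, hxw⟩

/-- Appendix corollary for C^b-S5₂: any world reachable via `R i` and `R j` in an
arbitrary number of steps is reachable in exactly `2b` steps. -/
theorem reachable_in_2b_steps {W I : Type*} (R : I → W → W → Prop) (i j : I) (hij : i ≠ j)
    (hEi : Equivalence (R i)) (hEj : Equivalence (R j))
    (b : ℕ) (hb : 1 ≤ b)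
    (hC₁ : ∀ w v : W, comp R (alt j i (2 * b)) w v → comp R (alt i j (2 * b)) w v)
    (hC₂ : ∀ w v : W, comp R (alt i j (2 * b)) w v → comp R (alt j i (2 * b)) w v) :
    ∀ w w' : W,
      Relation.ReflTransGen (fun a b' => R i a b' ∨ R j a b') w w' →
        comp R (alt i j (2 * b)) w w' := by
  intro w w' h
  have hk : 1 ≤ 2 * b := by omega
  induction h using Relation.ReflTransGen.head_induction_on with
  | refl => exact comp_alt_refl R i j hEi.refl hEj.refl _ _
  | head hstep _ ih =>
    rcases hstep with hi | hj
    · exact comp_alt_of_rel_of_comp_alt R i j hEi.trans hk hi ih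
    · exact hC₁ _ _ (comp_alt_of_rel_of_comp_alt R j i hEj.trans hk hj (hC₂ _ _ ih))
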